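/- For n ∈ ℕ let X_n be a random variable with Gamma distribution with parameters (n,1), i.e., with density x ↦ x^{n−1} e^{−x}/Γ(n) on (0,∞), so that E[X_n^{s}] = Γ(n+s)/Γ(n) for complex s with Re(s) > −n, and let ψ(n) = Γ'(n)/Γ(n) be the digamma function. Then, uniformly as t ranges over any compact subset of ℂ ∖ (−∞,−1], one has lim_{n→∞} [ e^{−t n ψ(n)} · Γ((t+1)n) / Γ(n) ] / e^{n((t+1)log(t+1) − t)} = e^{t/2} / √(t+1), where log and the square root are the principal branches; equivalently, E[e^{tn(log X_n − ψ(n))}] / e^{n((t+1)log(t+1) − t)} → e^{t/2}/√(t+1). -/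

import Mathlib

open MeasureTheory Real Filter Finset

/-- The digamma function `ψ = (log Γ)'` on `(0,∞)`. -/
noncomputable def digamma (z : ℝ) : ℝ := deriv (fun x => Real.log (Real.Gamma x)) z

/-- The slit plane `ℂ ∖ (−∞, −1]`. -/
def slitPlane' : Set ℂ := {t : ℂ | ¬(t.im = 0 ∧ t.re ≤ -1)}

open Topology

noncomputable def stF (z : ℂ) : ℂ :=
  Complex.Gamma z / Complex.exp ((z - 1/2) * Complex.log z - z)

noncomputable def stH (z : ℂ) : ℂ :=
  (z + 1/2) * (Complex.log (z + 1) - Complex.log z) - 1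

lemma slit_add {z : ℂ} (hz : z ∈ Complex.slitPlane) (k : ℕ) : z + k ∈ Complex.slitPlane := by
  rw [Complex.mem_slitPlane_iff] at *
  have : (0:ℝ) ≤ k := Nat.cast_nonneg k
  rcases hz with h | h
  · left; simp; linarith
  · right; simpa using h

lemma slit_add_one {z : ℂ} (hz : z ∈ Complex.slitPlane) : z + 1 ∈ Complex.slitPlane := by
  simpa using slit_add hz 1

lemma slit_ne_neg_nat {z : ℂ} (hz : z ∈ Complex.slitPlane) (k : ℕ) : z ≠ -k := by
  rintro rfl
  rw [Complex.mem_slitPlane_iff] at hz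
  have : (0:ℝ) ≤ k := Nat.cast_nonneg k
  rcases hz with h | h
  · simp at h; linarith
  · simp at h

lemma stF_ne_zero {z : ℂ} (hz : z ∈ Complex.slitPlane) : stF z ≠ 0 :=
  div_ne_zero (Complex.Gamma_ne_zero (slit_ne_neg_nat hz)) (Complex.exp_ne_zero _)

lemma stF_step {z : ℂ} (hz : z ∈ Complex.slitPlane) :
    stF z = stF (z + 1) * Complex.exp (stH z) := by
  have h0 := Complex.slitPlane_ne_zero hz
  unfold stF stH
  rw [Complex.Gamma_add_one z h0, div_mul_eq_mul_div, div_eq_div_iff (Complex.exp_ne_zero _) (Complex.exp_ne_zero _)]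
  conv_rhs => rw [← Complex.exp_log h0]
  have e : Complex.Gamma (Complex.exp (Complex.log z)) = Complex.Gamma z := by
    rw [Complex.exp_log h0]
  rw [e, mul_comm (Complex.exp _) (Complex.Gamma z), mul_assoc, mul_assoc, ← Complex.exp_add,
    ← Complex.exp_add, Complex.exp_log h0]
  congr 2
  ring

lemma stF_iter {z : ℂ} (hz : z ∈ Complex.slitPlane) (N : ℕ) :
    stF z = stF (z + N) * Complex.exp (∑ k ∈ range N, stH (z + k)) := by
  induction N with
  | zero => simp
  | succ N ih =>
    rw [ih, stF_step (slit_add hz N), sum_range_succ, Complex.exp_add]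
    push_cast
    rw [add_assoc z N 1]
    ring

lemma log_add_one_sub {z : ℂ} (hz : z ∈ Complex.slitPlane) :
    Complex.log (z + 1) - Complex.log z = Complex.log (1 + z⁻¹) := by
  have h0 := Complex.slitPlane_ne_zero hz
  have hn : 0 < Complex.normSq z := Complex.normSq_pos.2 h0
  have e : z + 1 = z * (1 + z⁻¹) := by field_simp
  have h1 : 1 + z⁻¹ ≠ 0 := by
    intro h
    rw [h, mul_zero] at e
    exact Complex.slitPlane_ne_zero (slit_add_one hz) e
  have him : (1 + z⁻¹).im = -z.im / Complex.normSq z := by simp [Complex.inv_im]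
  have hre : (1 + z⁻¹).re = 1 + z.re / Complex.normSq z := by simp [Complex.inv_re]
  rw [e, Complex.log_mul h0 h1]
  · ring
  have a1 := Complex.arg_mem_Ioc z
  have a2 := Complex.arg_mem_Ioc (1 + z⁻¹)
  rcases lt_trichotomy z.im 0 with h | h | h
  · have b1 := Complex.arg_neg_iff.2 h
    have b2 : 0 ≤ Complex.arg (1 + z⁻¹) := Complex.arg_nonneg_iff.2 (by rw [him]; apply div_nonneg <;> linarith)
    constructor <;> linarith [a1.1, a1.2, a2.1, a2.2]
  · have hr : 0 < z.re := by
      rw [Complex.mem_slitPlane_iff] at hz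
      tauto
    have b1 : Complex.arg z = 0 := Complex.arg_eq_zero_iff.2 ⟨hr.le, h⟩
    rw [b1, zero_add]; exact a2
  · have b1 : 0 ≤ Complex.arg z := Complex.arg_nonneg_iff.2 h.le
    have b2 : Complex.arg (1 + z⁻¹) < 0 := Complex.arg_neg_iff.2 (by rw [him]; apply div_neg_of_neg_of_pos <;> linarith)
    constructor <;> linarith [a1.1, a1.2, a2.1, a2.2]

lemma log_taylor2 {u : ℂ} (hu : ‖u‖ ≤ 1/2) :
    ‖Complex.log (1 + u) - (u - u^2/2)‖ ≤ ‖u‖^3 := by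
  have h := Complex.norm_log_sub_logTaylor_le 2 (z := u) (by linarith)
  have e : Complex.logTaylor 3 u = u - u^2/2 := by
    simp [Complex.logTaylor, sum_range_succ]; ring
  norm_num [e] at h
  refine h.trans ?_
  have : (1 - ‖u‖)⁻¹ ≤ 2 := by
    rw [inv_le_comm₀] <;> linarith
  have h3 : 0 ≤ ‖u‖^3 := by positivity
  nlinarith [mul_le_mul_of_nonneg_left this h3]

lemma stH_bound {z : ℂ} (hz : z ∈ Complex.slitPlane) (h2 : 2 ≤ ‖z‖) :
    ‖stH z‖ ≤ 2 / ‖z‖^2 := by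
  have h0 := Complex.slitPlane_ne_zero hz
  have hu : ‖z⁻¹‖ ≤ 1/2 := by
    rw [norm_inv, one_div]; exact inv_anti₀ (by norm_num) h2
  have ht := log_taylor2 hu
  set r := Complex.log (1 + z⁻¹) - (z⁻¹ - z⁻¹^2/2) with hr
  have e : stH z = -(z⁻¹^2)/4 + (z + 1/2) * r := by
    unfold stH
    rw [log_add_one_sub hz, hr]
    field_simp
    ring
  rw [e]
  have hz' : ‖z‖ = ‖z⁻¹‖⁻¹ := by simp
  have hp : 0 < ‖z⁻¹‖ := norm_pos_iff.2 (inv_ne_zero h0)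
  calc _ ≤ ‖-(z⁻¹^2)/4‖ + ‖(z + 1/2) * r‖ := norm_add_le _ _
    _ ≤ ‖z⁻¹‖^2/4 + (‖z‖ + 1/2) * ‖z⁻¹‖^3 := by
        gcongr
        · simp
        · rw [norm_mul]
          gcongr
          refine (norm_add_le _ _).trans ?_
          simp
    _ ≤ 2 * ‖z⁻¹‖^2 := by
        rw [hz']
        generalize ‖z⁻¹‖ = x at *
        have : (x⁻¹ + 1/2) * x^3 = x^2 + x^2 * x/2 := by field_simp
        rw [this]
        nlinarith [sq_nonneg x]
    _ = _ := by rw [norm_inv]; field_simp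

lemma sum_inv_sq {n : ℕ} (hn : 2 ≤ n) (N : ℕ) :
    ∑ k ∈ range N, 1 / ((n:ℝ) + k)^2 ≤ 1 / ((n:ℝ) - 1) := by
  have hn' : (2:ℝ) ≤ n := by exact_mod_cast hn
  suffices h : ∑ k ∈ range N, 1 / ((n:ℝ) + k)^2 ≤ 1 / ((n:ℝ) - 1) - 1 / ((n:ℝ) + N - 1) by
    refine h.trans ?_
    have : 0 ≤ 1 / ((n:ℝ) + N - 1) := by
      apply div_nonneg zero_le_one
      have : (0:ℝ) ≤ N := Nat.cast_nonneg N
      linarith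
    linarith
  induction N with
  | zero => simp
  | succ N ih =>
    rw [sum_range_succ]
    have hN : (0:ℝ) ≤ N := Nat.cast_nonneg N
    have : 1 / ((n:ℝ) + N)^2 ≤ 1 / ((n:ℝ) + N - 1) - 1 / ((n:ℝ) + N) := by
      rw [div_sub_div _ _ (by linarith) (by linarith), div_le_div_iff₀ (by nlinarith) (by nlinarith)]
      nlinarith
    push_cast
    have e : (n:ℝ) + (N + 1) - 1 = n + N := by ring
    rw [e]; linarith

lemma Gamma_add_nat' {z : ℂ} (hz : z ∈ Complex.slitPlane) (m : ℕ) :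
    Complex.Gamma (z + m) = (∏ j ∈ range m, (z + j)) * Complex.Gamma z := by
  induction m with
  | zero => simp
  | succ m ih =>
    rw [prod_range_succ]
    push_cast
    rw [← add_assoc, Complex.Gamma_add_one _ (Complex.slitPlane_ne_zero (slit_add hz m)), ih]
    ring

lemma Gamma_shift_tendsto {z : ℂ} (hz : z ∈ Complex.slitPlane) :
    Tendsto (fun N : ℕ => Complex.Gamma (z + (N + 1 : ℕ)) / ((N:ℂ)^z * Nat.factorial N)) atTop (𝓝 1) := by
  have hG := Complex.Gamma_ne_zero (slit_ne_neg_nat hz)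
  have h := (tendsto_const_nhds (x := Complex.Gamma z)).div (Complex.GammaSeq_tendsto_Gamma z) hG
  rw [div_self hG] at h
  refine h.congr fun N => ?_
  simp only [Pi.div_apply]
  rw [Gamma_add_nat' hz]
  unfold Complex.GammaSeq
  rw [div_div_eq_mul_div, mul_comm]

lemma stF_ratio {z : ℂ} (hz : z ∈ Complex.slitPlane) :
    Tendsto (fun N : ℕ => stF (z + (N + 1 : ℕ)) / stF ((N + 1 : ℕ))) atTop (𝓝 1) := by
  have hmain : Tendsto (fun N : ℕ => z * (Complex.log N - Complex.log ((N+1:ℕ):ℂ))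
      + (z + N + 1/2) * (Complex.log ((N+1:ℕ):ℂ) - Complex.log (z + (N+1:ℕ))) + z) atTop (𝓝 0) := by
    have hc : Tendsto (fun N : ℕ => ((N + 1 : ℕ) : ℝ)) atTop atTop :=
      tendsto_natCast_atTop_atTop.comp (tendsto_add_atTop_nat 1)
    have hL1 : Tendsto (fun N : ℕ => ((N + 1 : ℕ) : ℂ) * Complex.log (1 + z / ((N + 1 : ℕ) : ℂ)))
        atTop (𝓝 z) := by
      have h := Complex.tendsto_mul_log_one_add_of_tendsto (g := fun x => z / x) (t := z) (by
        refine tendsto_const_nhds.congr' ?_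
        filter_upwards [eventually_gt_atTop 0] with x hx
        have : (x:ℂ) ≠ 0 := by exact_mod_cast hx.ne'
        field_simp)
      exact (h.comp hc).congr fun N => by simp
    have hlim (w : ℂ) (f : ℕ → ℂ) (hf : Tendsto f atTop (𝓝 0)) :
        Tendsto (fun N => Complex.log (1 + w * f N)) atTop (𝓝 0) := by
      have h1 : Tendsto (fun N => 1 + w * f N) atTop (𝓝 1) := by
        simpa using (hf.const_mul w).const_add 1
      have := h1.clog Complex.one_mem_slitPlane
      simpa using this
    have hi : Tendsto (fun N : ℕ => ((N : ℂ))⁻¹) atTop (𝓝 0) :=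
      tendsto_inv_atTop_nhds_zero_nat (𝕜 := ℂ)
    have hi1 : Tendsto (fun N : ℕ => (((N + 1 : ℕ) : ℂ))⁻¹) atTop (𝓝 0) :=
      hi.comp (tendsto_add_atTop_nat 1)
    have hL2 := hlim z _ hi1
    have hL3 := hlim 1 _ hi
    have hall := (((hL3.const_mul (-z)).sub hL1).add (tendsto_const_nhds (x := z))).sub
      (hL2.const_mul (z - 1/2))
    simp only [mul_zero, zero_sub, neg_add_cancel, sub_zero] at hall
    refine hall.congr' ?_
    have hne : ∀ᶠ N : ℕ in atTop, 1 + z * (((N + 1 : ℕ) : ℂ))⁻¹ ≠ 0 := by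
      have h1 : Tendsto (fun N : ℕ => 1 + z * (((N + 1 : ℕ) : ℂ))⁻¹) atTop (𝓝 1) := by
        simpa using (hi1.const_mul z).const_add 1
      exact h1.eventually_ne one_ne_zero
    filter_upwards [hne, eventually_gt_atTop 0] with N hN hN0
    have hs : (N : ℂ) ∈ Complex.slitPlane := by
      rw [Complex.mem_slitPlane_iff]; left; simpa using hN0
    have e1 := log_add_one_sub hs
    have e2 : Complex.log (z + (N+1:ℕ)) = Complex.log ((N+1:ℕ):ℂ)
        + Complex.log (1 + z * (((N + 1 : ℕ) : ℂ))⁻¹) := by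
      have hp : (0:ℝ) < ((N+1:ℕ):ℝ) := by positivity
      have h := Complex.log_ofReal_mul hp hN
      rw [Complex.ofReal_log hp.le] at h
      simp only [Complex.ofReal_natCast] at h
      rw [← h]
      congr 1
      have : ((N+1:ℕ):ℂ) ≠ 0 := by exact_mod_cast (Nat.succ_ne_zero N)
      field_simp
      ring
    rw [e2, one_mul, ← e1, div_eq_mul_inv]
    push_cast
    ring
  have h := (Gamma_shift_tendsto hz).mul ((Complex.continuous_exp.tendsto 0).comp hmain)
  simp only [Complex.exp_zero, mul_one] at h
  refine h.congr' ?_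
  filter_upwards [eventually_gt_atTop 0] with N hN
  have hN0 : (N:ℂ) ≠ 0 := by exact_mod_cast hN.ne'
  unfold stF
  have hf : (Nat.factorial N : ℂ) ≠ 0 := by exact_mod_cast Nat.factorial_ne_zero N
  have e1 : Complex.Gamma ((N + 1 : ℕ):ℂ) = Nat.factorial N := by
    push_cast; exact Complex.Gamma_nat_eq_factorial N
  rw [e1, Complex.cpow_def_of_ne_zero hN0]
  simp only [Function.comp]
  rw [div_div_div_eq, div_mul_eq_mul_div, div_eq_div_iff (mul_ne_zero (Complex.exp_ne_zero _) hf) (mul_ne_zero (Complex.exp_ne_zero _) hf)]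
  have key : ∀ G f a b c d : ℂ, a * b = c * d → G * b * (a * f) = G * c * (d * f) := by
    intro G f a b c d h
    linear_combination G * f * h
  apply key
  rw [← Complex.exp_add, ← Complex.exp_add]
  congr 1
  push_cast
  ring

noncomputable def dgG (n : ℕ) : ℝ := digamma n - Real.log n + 1 / (2 * n)

lemma digamma_nat (m : ℕ) : digamma ((m + 1 : ℕ) : ℝ) = -eulerMascheroniConstant + harmonic m := by
  unfold digamma
  have h := Real.hasDerivAt_Gamma_nat m
  have hG : Real.Gamma (m + 1) = Nat.factorial m := Real.Gamma_nat_eq_factorial m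
  have hf : (Nat.factorial m : ℝ) ≠ 0 := by exact_mod_cast Nat.factorial_ne_zero m
  have := (h.log (by rw [hG]; exact hf)).deriv
  push_cast
  rw [this, hG]
  field_simp

lemma dgG_tendsto : Tendsto dgG atTop (𝓝 0) := by
  rw [← tendsto_add_atTop_iff_nat 1]
  have h1 := Real.tendsto_harmonic_sub_log_add_one
  have h2 : Tendsto (fun n : ℕ => (1/2 : ℝ) * ((n + 1 : ℕ) : ℝ)⁻¹) atTop (𝓝 0) := by
    simpa using ((tendsto_inv_atTop_nhds_zero_nat (𝕜 := ℝ)).comp (tendsto_add_atTop_nat 1)).const_mul (1/2 : ℝ)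
  have h := (h1.sub (tendsto_const_nhds (x := eulerMascheroniConstant))).add h2
  rw [sub_self, add_zero] at h
  refine h.congr fun n => ?_
  unfold dgG
  rw [digamma_nat]
  push_cast
  have : (n:ℝ) + 1 ≠ 0 := by positivity
  field_simp
  ring

lemma dgG_step {n : ℕ} (hn : 2 ≤ n) : |dgG n - dgG (n + 1)| ≤ 2 / (n:ℝ)^3 := by
  have hn' : (2:ℝ) ≤ n := by exact_mod_cast hn
  have hu : ‖((n:ℂ))⁻¹‖ ≤ 1/2 := by
    rw [norm_inv, one_div]; exact inv_anti₀ (by norm_num) (by simpa using hn')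
  have ht := log_taylor2 hu
  have e : Complex.log (1 + (n:ℂ)⁻¹) - ((n:ℂ)⁻¹ - (n:ℂ)⁻¹^2/2)
      = ((Real.log (1 + (n:ℝ)⁻¹) - ((n:ℝ)⁻¹ - (n:ℝ)⁻¹^2/2) : ℝ) : ℂ) := by
    push_cast
    rw [Complex.ofReal_log (by positivity)]
    push_cast
    rfl
  rw [e, Complex.norm_real, norm_inv, Complex.norm_natCast, Real.norm_eq_abs] at ht
  have hl : Real.log ((n + 1 : ℕ) : ℝ) - Real.log n = Real.log (1 + (n:ℝ)⁻¹) := by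
    rw [← Real.log_div (by positivity) (by positivity)]
    congr 1
    push_cast
    field_simp
  obtain ⟨m, rfl⟩ : ∃ m, n = m + 1 := ⟨n - 1, by omega⟩
  have hd : digamma ((m + 1 + 1 : ℕ) : ℝ) = digamma ((m + 1 : ℕ) : ℝ) + (((m + 1 : ℕ) : ℝ))⁻¹ := by
    rw [digamma_nat, digamma_nat, harmonic_succ]
    push_cast
    ring
  unfold dgG
  rw [hd]
  set x : ℝ := ((m + 1 : ℕ) : ℝ) with hx
  have hx1 : ((m + 1 + 1 : ℕ) : ℝ) = x + 1 := by rw [hx]; push_cast; ring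
  set l := Real.log (1 + x⁻¹)
  have e2 : digamma x - Real.log x + 1 / (2 * x) - (digamma x + x⁻¹ - Real.log ((m + 1 + 1 : ℕ) : ℝ) + 1 / (2 * ((m + 1 + 1 : ℕ) : ℝ)))
     = (l - (x⁻¹ - x⁻¹^2/2)) - 1 / (2 * x^2 * (x+1)) := by
    rw [← hl, hx1]
    have h1 : x + 1 ≠ 0 := by positivity
    have h2 : x ≠ 0 := by positivity
    field_simp
    ring
  rw [e2]
  have h3 : |1 / (2 * x^2 * (x+1))| ≤ 1 / x^3 := by
    rw [abs_of_nonneg (by positivity)]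
    apply one_div_le_one_div_of_le (by positivity)
    have : 0 ≤ x^2 := by positivity
    nlinarith
  calc _ ≤ _ := abs_sub _ _
    _ ≤ x⁻¹^3 + 1/x^3 := add_le_add ht h3
    _ = 2 / x^3 := by rw [inv_pow]; ring

lemma dgG_bound {n : ℕ} (hn : 2 ≤ n) : |dgG n| ≤ 2 / n * (1 / ((n:ℝ) - 1)) := by
  have hn' : (2:ℝ) ≤ n := by exact_mod_cast hn
  have h : ∀ N : ℕ, |dgG n - dgG (n + N)| ≤ 2 / n * (1 / ((n:ℝ) - 1)) := by
    intro N
    refine le_trans ?_ (mul_le_mul_of_nonneg_left (sum_inv_sq hn N) (by positivity))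
    rw [mul_sum]
    induction N with
    | zero => simp
    | succ N ih =>
      rw [sum_range_succ]
      have h1 := dgG_step (n := n + N) (by omega)
      have h2 : 2 / ((n + N : ℕ):ℝ)^3 ≤ 2 / n * (1 / ((n:ℝ) + N)^2) := by
        push_cast
        rw [div_mul_div_comm, mul_one]
        apply div_le_div_of_nonneg_left (by norm_num) (by positivity)
        have : (0:ℝ) ≤ N := Nat.cast_nonneg N
        rw [pow_succ' _ 2]
        gcongr
        linarith
      calc _ = |(dgG n - dgG (n + N)) + (dgG (n+N) - dgG (n + N + 1))| := by
            congr 1; rw [← add_assoc]; ring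
        _ ≤ _ := abs_add_le _ _
        _ ≤ _ := add_le_add ih (h1.trans h2)
  have ht : Tendsto (fun N => |dgG n - dgG (n + N)|) atTop (𝓝 |dgG n - 0|) := by
    refine (tendsto_const_nhds.sub ?_).abs
    have := (tendsto_add_atTop_iff_nat n).2 dgG_tendsto
    exact this.congr fun N => by rw [add_comm]
  rw [sub_zero] at ht
  exact le_of_tendsto' ht h

lemma digamma_asymp : Tendsto (fun n : ℕ => (n:ℝ) * (Real.log n - digamma n)) atTop (𝓝 (1/2)) := by
  have h1 : Tendsto (fun n : ℕ => (n:ℝ) * dgG n) atTop (𝓝 0) := by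
    have hb : Tendsto (fun n : ℕ => 2 * (1 / ((n:ℝ) - 1))) atTop (𝓝 0) := by
      have : Tendsto (fun n : ℕ => (n:ℝ) - 1) atTop atTop :=
        tendsto_atTop_add_const_right _ _ tendsto_natCast_atTop_atTop
      simpa using this.inv_tendsto_atTop.const_mul 2
    refine squeeze_zero_norm' ?_ hb
    filter_upwards [eventually_ge_atTop 2] with n hn
    have hn' : (2:ℝ) ≤ n := by exact_mod_cast hn
    rw [norm_mul, Real.norm_natCast, Real.norm_eq_abs]
    refine (mul_le_mul_of_nonneg_left (dgG_bound hn) (by positivity)).trans (le_of_eq ?_)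
    have : (n:ℝ) - 1 ≠ 0 := by linarith
    field_simp
  have h2 := (tendsto_const_nhds (x := (1/2:ℝ))).sub h1
  rw [sub_zero] at h2
  refine h2.congr' ?_
  filter_upwards [eventually_ge_atTop 2] with n hn
  have hn' : (2:ℝ) ≤ n := by exact_mod_cast hn
  unfold dgG
  field_simp
  ring

lemma cone_bound (K : Set ℂ) (hK : IsCompact K) (hK' : K ⊆ Complex.slitPlane) :
    ∃ c : ℝ, 0 < c ∧ c ≤ 1 ∧ ∀ w ∈ K, ∀ n k : ℕ, 0 < n → c * ((n:ℝ) + k) ≤ ‖(n:ℂ) * w + k‖ := by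
  let S : Set (ℂ × ℝ) := (insert 1 K) ×ˢ Set.Icc (0:ℝ) 1
  have hS : IsCompact S := (hK.insert 1).prod isCompact_Icc
  have hSn : S.Nonempty := ⟨(1, 0), by simp [S]⟩
  let f : ℂ × ℝ → ℝ := fun p => ‖(1 - (p.2:ℂ)) * p.1 + p.2‖
  have hf : Continuous f := by fun_prop
  obtain ⟨p, hp, hmin⟩ := hS.exists_isMinOn hSn hf.continuousOn
  have hpos : 0 < f p := by
    have h1 : p.1 ∈ Complex.slitPlane := by
      rcases hp.1 with h | h
      · rw [h]; exact Complex.one_mem_slitPlane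
      · exact hK' h
    have := Complex.starConvex_one_slitPlane h1 hp.2.1 (sub_nonneg.2 hp.2.2) (by ring)
    have h0 := Complex.slitPlane_ne_zero this
    apply norm_pos_iff.2
    convert h0 using 1
    simp
    ring
  refine ⟨f p, hpos, ?_, ?_⟩
  · have h := hmin (show ((1:ℂ), (0:ℝ)) ∈ S by simp [S])
    simpa [f] using h
  · intro w hw n k hn
    have hn' : (0:ℝ) < n := by exact_mod_cast hn
    have hk : (0:ℝ) ≤ k := Nat.cast_nonneg k
    have hnk : (0:ℝ) < n + k := by linarith
    have h := hmin (show (w, (k:ℝ) / (n + k)) ∈ S from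
      ⟨Or.inr hw, by positivity, by rw [div_le_one hnk]; linarith⟩)
    have h : f p ≤ f (w, (k:ℝ) / (n + k)) := h
    have e : ‖(n:ℂ) * w + k‖ = f (w, (k:ℝ) / (n + k)) * (n + k) := by
      have hc : (n:ℂ) + k ≠ 0 := by exact_mod_cast hnk.ne'
      have hnorm : ‖(n:ℂ) + k‖ = n + k := by
        rw [← Nat.cast_add, Complex.norm_natCast]; push_cast; rfl
      simp only [f]
      refine Eq.trans ?_ (congrArg (_ * ·) hnorm)
      rw [← norm_mul]
      congr 1
      push_cast
      field_simp
      ring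
    rw [e]
    gcongr

lemma nat_slit {n : ℕ} (hn : 0 < n) : (n : ℂ) ∈ Complex.slitPlane := by
  rw [Complex.mem_slitPlane_iff]; left; simpa using hn

lemma mul_slit {n : ℕ} (hn : 0 < n) {w : ℂ} (hw : w ∈ Complex.slitPlane) :
    (n : ℂ) * w ∈ Complex.slitPlane := by
  have hn' : (0:ℝ) < n := by exact_mod_cast hn
  rw [Complex.mem_slitPlane_iff] at *
  rcases hw with h | h
  · left; simp; positivity
  · right; simp [h, hn.ne']

lemma stF_quot_bound (c : ℝ) (hc : 0 < c) (hc1 : c ≤ 1) (n : ℕ) (hn : 2 ≤ n) (hcn : 2 ≤ c * n)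
    (hε : 4 / c^2 * (1 / ((n:ℝ) - 1)) ≤ 1)
    (w : ℂ) (hw : w ∈ Complex.slitPlane) (hb : ∀ k : ℕ, c * ((n:ℝ) + k) ≤ ‖(n:ℂ) * w + k‖) :
    ‖stF (n * w) / stF n - 1‖ ≤ 2 * (4 / c^2 * (1 / ((n:ℝ) - 1))) := by
  have hn0 : 0 < n := by omega
  have hn' : (2:ℝ) ≤ n := by exact_mod_cast hn
  have s1 := mul_slit hn0 hw
  have s2 := nat_slit hn0
  let S : ℕ → ℂ := fun N => ∑ k ∈ range N, (stH (n * w + k) - stH (n + k))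
  have hS : ∀ N, ‖S N‖ ≤ 4 / c^2 * (1 / ((n:ℝ) - 1)) := by
    intro N
    refine le_trans (norm_sum_le _ _) (le_trans ?_ (mul_le_mul_of_nonneg_left (sum_inv_sq hn N) (by positivity)))
    rw [mul_sum]
    refine sum_le_sum fun k _ => ?_
    have hk : (0:ℝ) ≤ k := Nat.cast_nonneg k
    have hck : 2 ≤ c * (n + k) := by nlinarith
    have b : ∀ z : ℂ, z ∈ Complex.slitPlane → c * ((n:ℝ) + k) ≤ ‖z‖ →
        ‖stH z‖ ≤ 2 / c^2 * (1 / ((n:ℝ) + k)^2) := by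
      intro z hz hle
      refine (stH_bound hz (hck.trans hle)).trans ?_
      rw [div_mul_div_comm, mul_one, ← mul_pow]
      gcongr
    have b1 := b _ (slit_add s1 k) (hb k)
    have b2 := b _ (slit_add s2 k) (by
      have hnorm : ‖(n:ℂ) + k‖ = n + k := by
        rw [← Nat.cast_add, Complex.norm_natCast]; push_cast; rfl
      rw [hnorm]
      nlinarith)
    calc _ ≤ _ := norm_sub_le _ _
      _ ≤ _ := add_le_add b1 b2
      _ = _ := by ring
  have hexp : ∀ N, ‖Complex.exp (S N) - 1‖ ≤ 2 * (4 / c^2 * (1 / ((n:ℝ) - 1))) := by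
    intro N
    refine (Complex.norm_exp_sub_one_le ((hS N).trans hε)).trans ?_
    linarith [hS N]
  let R : ℕ → ℂ := fun N => stF (n * w + (N + 1 : ℕ)) / stF (n + (N+1:ℕ))
  have hR : Tendsto R atTop (𝓝 1) := by
    have h := (stF_ratio s1).div (stF_ratio s2) one_ne_zero
    rw [div_one] at h
    refine h.congr fun N => ?_
    simp only [Pi.div_apply, R]
    exact div_div_div_cancel_right₀ (stF_ne_zero (nat_slit (Nat.succ_pos N))) _ _
  have hQ : ∀ N, stF (n * w) / stF n = R N * Complex.exp (S (N+1)) := by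
    intro N
    rw [stF_iter s1 (N+1), stF_iter s2 (N+1)]
    simp only [R, S]
    rw [sum_sub_distrib, Complex.exp_sub, mul_div_mul_comm]
  have hQ0 : ∀ N, Complex.exp (S (N+1)) = stF (n * w) / stF n / R N := by
    intro N
    have : R N ≠ 0 := div_ne_zero (stF_ne_zero (slit_add s1 _)) (stF_ne_zero (slit_add s2 _))
    rw [hQ N]; field_simp
  have hlim : Tendsto (fun N => ‖Complex.exp (S (N+1)) - 1‖) atTop (𝓝 ‖stF (n * w) / stF n / 1 - 1‖) := by
    simp only [hQ0]
    exact (((tendsto_const_nhds).div hR one_ne_zero).sub_const 1).norm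
  rw [div_one] at hlim
  exact le_of_tendsto' hlim fun N => hexp (N+1)


lemma main_eq (n : ℕ) (hn : 0 < n) (t : ℂ) (ht : t + 1 ∈ Complex.slitPlane) (d : ℝ) :
    Complex.exp (-(t * n * (d : ℝ))) * Complex.Gamma ((t + 1) * n)
            / Complex.Gamma n
          / Complex.exp (n * ((t + 1) * Complex.log (t + 1) - t))
    = stF (n * (t + 1)) / stF n * (Complex.exp (t * ((n * (Real.log n - d) : ℝ) : ℂ)) / (t + 1) ^ (1 / 2 : ℂ)) := by
  have hn' : (0:ℝ) < n := by exact_mod_cast hn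
  have h0 := Complex.slitPlane_ne_zero ht
  have hG : ∀ z, Complex.Gamma z = stF z * Complex.exp ((z - 1/2) * Complex.log z - z) := by
    intro z
    unfold stF
    rw [div_mul_cancel₀ _ (Complex.exp_ne_zero _)]
  have hl := Complex.log_ofReal_mul hn' h0
  rw [Complex.ofReal_natCast] at hl
  have hl2 : Complex.log (n:ℂ) = (Real.log n : ℂ) := by
    rw [Complex.ofReal_log hn'.le, Complex.ofReal_natCast]
  rw [hG ((t+1) * n), hG n, mul_comm (t+1) (n:ℂ), hl, hl2, Complex.cpow_def_of_ne_zero h0]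
  have key : ∀ A B a b c d e f : ℂ, a + b - c - d = e - f →
      Complex.exp a * (A * Complex.exp b) / (B * Complex.exp c) / Complex.exp d
       = A / B * (Complex.exp e / Complex.exp f) := by
    intro A B a b c d e f h
    rw [← Complex.exp_sub, ← h, Complex.exp_sub, Complex.exp_sub, Complex.exp_add]
    ring_nf
    try simp only [mul_inv]
    try ring
  apply key
  push_cast
  ring

theorem stmt17 (K : Set ℂ) (hK : IsCompact K) (hK' : K ⊆ slitPlane') :
    TendstoUniformlyOn
      (fun (n : ℕ) (t : ℂ) =>
        -- E[e^{t n (log X_n − ψ(n))}] = e^{−t n ψ(n)} Γ((t+1)n)/Γ(n)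
        Complex.exp (-(t * n * (digamma n : ℝ))) * Complex.Gamma ((t + 1) * n)
            / Complex.Gamma n
          / Complex.exp (n * ((t + 1) * Complex.log (t + 1) - t)))
      (fun t => Complex.exp (t / 2) / (t + 1) ^ (1 / 2 : ℂ))
      atTop K := by
  have hsl : ∀ t ∈ K, t + 1 ∈ Complex.slitPlane := by
    intro t ht
    have h := hK' ht
    simp only [slitPlane', Set.mem_ofPred_eq] at h
    rw [Complex.mem_slitPlane_iff]
    by_cases him : t.im = 0
    · left
      have : ¬ t.re ≤ -1 := fun h2 => h ⟨him, h2⟩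
      simp; linarith
    · right; simpa using him
  obtain ⟨c, hc, hc1, hcone⟩ := cone_bound ((fun t => t + 1) '' K)
    (hK.image (by fun_prop)) (by rintro _ ⟨t, ht, rfl⟩; exact hsl t ht)
  -- the quotient of normalised Gammas tends to 1
  have hq : TendstoUniformlyOn (fun (n : ℕ) (t : ℂ) => stF (n * (t + 1)) / stF n) (fun _ => 1)
      atTop K := by
    rw [Metric.tendstoUniformlyOn_iff]
    intro ε hε
    have hb : Tendsto (fun n : ℕ => 4 / c^2 * (1 / ((n:ℝ) - 1))) atTop (𝓝 0) := by
      have : Tendsto (fun n : ℕ => (n:ℝ) - 1) atTop atTop :=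
        tendsto_atTop_add_const_right _ _ tendsto_natCast_atTop_atTop
      simpa using this.inv_tendsto_atTop.const_mul (4 / c^2)
    have hcn : Tendsto (fun n : ℕ => c * (n:ℝ)) atTop atTop :=
      tendsto_natCast_atTop_atTop.const_mul_atTop hc
    filter_upwards [eventually_ge_atTop 2, hcn.eventually_ge_atTop 2, hb.eventually_lt_const one_pos,
      hb.eventually_lt_const (half_pos hε)] with n h1 h2 h3 h4 t ht
    rw [dist_comm, dist_eq_norm]
    refine (stF_quot_bound c hc hc1 n h1 h2 h3.le (t+1) (hsl t ht)
      (fun k => hcone _ ⟨t, ht, rfl⟩ n k (by omega))).trans_lt ?_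
    linarith
  -- the exponential factor
  have hg : ContinuousOn (fun p : ℝ × ℂ => Complex.exp (p.2 * (p.1 : ℂ)) / (p.2 + 1) ^ (1 / 2 : ℂ))
      (Set.univ ×ˢ K) := by
    refine ContinuousOn.div (by fun_prop) ?_ ?_
    · exact ContinuousOn.cpow (by fun_prop) (by fun_prop) fun p hp => hsl _ hp.2
    · intro p hp
      rw [Complex.cpow_def_of_ne_zero (Complex.slitPlane_ne_zero (hsl _ hp.2))]
      exact Complex.exp_ne_zero _
  have he : TendstoUniformlyOn (fun (a : ℝ) (t : ℂ) => Complex.exp (t * (a : ℂ)) / (t + 1) ^ (1 / 2 : ℂ))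
      (fun t => Complex.exp (t * ((1/2 : ℝ) : ℂ)) / (t + 1) ^ (1 / 2 : ℂ)) (𝓝 (1/2 : ℝ)) K := by
    have hu := (isCompact_Icc.prod hK).uniformContinuousOn_of_continuous
      (hg.mono (Set.prod_mono (Set.subset_univ (Set.Icc (0:ℝ) 1)) le_rfl))
    have := UniformContinuousOn.tendstoUniformlyOn
      (F := fun (a : ℝ) (t : ℂ) => Complex.exp (t * (a : ℂ)) / (t + 1) ^ (1 / 2 : ℂ)) hu
      (x := (1/2 : ℝ)) (by norm_num)
    rwa [nhdsWithin_eq_nhds.2 (Icc_mem_nhds (by norm_num) (by norm_num))] at this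
  have he2 : TendstoUniformlyOn (fun (n : ℕ) (t : ℂ) =>
      Complex.exp (t * ((n * (Real.log n - digamma n) : ℝ) : ℂ)) / (t + 1) ^ (1 / 2 : ℂ))
      (fun t => Complex.exp (t * ((1/2 : ℝ) : ℂ)) / (t + 1) ^ (1 / 2 : ℂ)) atTop K :=
    fun u hu => digamma_asymp.eventually (he u hu)
  have hfin : ContinuousOn (fun t => Complex.exp (t * ((1/2 : ℝ) : ℂ)) / (t + 1) ^ (1 / 2 : ℂ)) K :=
    hg.comp (f := fun t : ℂ => ((1/2 : ℝ), t)) (by fun_prop) (fun t ht => ⟨Set.mem_univ _, ht⟩)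
  rw [← tendstoLocallyUniformlyOn_iff_tendstoUniformlyOn_of_compact hK] at hq he2
  have hm := hq.mul₀ he2 continuousOn_const hfin
  rw [tendstoLocallyUniformlyOn_iff_tendstoUniformlyOn_of_compact hK] at hm
  have hm2 := hm.congr_right (g := fun t => Complex.exp (t / 2) / (t + 1) ^ (1 / 2 : ℂ)) (by
    intro t _
    simp only [Pi.mul_apply, one_mul]
    congr 2
    push_cast
    ring)
  refine hm2.congr ?_
  filter_upwards [eventually_gt_atTop 0] with n hn t ht
  exact (main_eq n hn t (hsl t ht) _).symm
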